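/- Let n ∈ ℕ and let A_R ∈ ℝⁿˣⁿ, B_R ∈ ℝⁿˣ³, C_R ∈ ℝ³ˣⁿ, D_R ∈ ℝ³ˣ³ be matrices, and let P ∈ ℝⁿˣⁿ be symmetric positive definite. Define the (3+n)×(3+n) matrix 𝒬 = [[D_R, (P·B_R + ½·C_Rᵀ)ᵀ],[P·B_R + ½·C_Rᵀ, A_RᵀP + P·A_R]], and assume zᵀ𝒬z < 0 for all nonzero z ∈ ℝ^(3+n). Let R : ℝ → ℝ³ˣ³ with R(t) ∈ SO(3) for all t and x : ℝ → ℝⁿ be differentiable curves satisfying the closed-loop attitude-loop dynamics x′(t) = A_R·x(t) + B_R·e(R(t)) and R′(t) = R(t)·(C_R·x(t) + D_R·e(R(t)))^×. Then the Lyapunov function V(t) = Ψ(R(t)) + x(t)ᵀ·P·x(t) is differentiable with V′(t) = z(t)ᵀ·𝒬·z(t), where z(t) = (e(R(t)), x(t)) ∈ ℝ^(3+n); in particular V′(t) < 0 whenever z(t) ≠ 0. -/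

import Mathlib

open Matrix

attribute [local instance] Matrix.normedAddCommGroup Matrix.normedSpace

/-- Membership in the special orthogonal group SO(3). -/
def SO3 (R : Matrix (Fin 3) (Fin 3) ℝ) : Prop :=
  Rᵀ * R = 1 ∧ R * Rᵀ = 1 ∧ R.det = 1

/-- The hat map `ℝ³ → ℝ³ˣ³`, sending a vector to its cross-product matrix. -/
def hat (x : Fin 3 → ℝ) : Matrix (Fin 3) (Fin 3) ℝ :=
  !![0, -x 2, x 1; x 2, 0, -x 0; -x 1, x 0, 0]

/-- The vee map, inverse of the hat map on skew-symmetric matrices. -/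
def vee (M : Matrix (Fin 3) (Fin 3) ℝ) : Fin 3 → ℝ :=
  ![M 2 1, M 0 2, M 1 0]

/-- The configuration error function `Ψ(R) = ½ tr(I - R)`. -/
noncomputable def Psi (R : Matrix (Fin 3) (Fin 3) ℝ) : ℝ :=
  (1 / 2 : ℝ) * ((1 : Matrix (Fin 3) (Fin 3) ℝ) - R).trace

/-- The attitude error vector `e(R) = ½ (R - Rᵀ)^∨`. -/
noncomputable def attErr (R : Matrix (Fin 3) (Fin 3) ℝ) : Fin 3 → ℝ :=
  (1 / 2 : ℝ) • vee (R - Rᵀ)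

/-- The block matrix `𝒬 = [[D_R, (P B_R + ½ C_Rᵀ)ᵀ], [P B_R + ½ C_Rᵀ, A_Rᵀ P + P A_R]]`. -/
noncomputable def Qmat {n : ℕ} (A_R : Matrix (Fin n) (Fin n) ℝ) (B_R : Matrix (Fin n) (Fin 3) ℝ)
    (C_R : Matrix (Fin 3) (Fin n) ℝ) (D_R : Matrix (Fin 3) (Fin 3) ℝ)
    (P : Matrix (Fin n) (Fin n) ℝ) : Matrix (Fin 3 ⊕ Fin n) (Fin 3 ⊕ Fin n) ℝ :=
  fromBlocks D_R (P * B_R + (1 / 2 : ℝ) • C_Rᵀ)ᵀ (P * B_R + (1 / 2 : ℝ) • C_Rᵀ)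
    (A_Rᵀ * P + P * A_R)

/-- Pairing with the attitude error is, up to sign, half the trace against the hat map. -/
theorem attErr_dotProduct (R : Matrix (Fin 3) (Fin 3) ℝ) (w : Fin 3 → ℝ) :
    attErr R ⬝ᵥ w = -(1 / 2 : ℝ) * (R * hat w).trace := by
  simp [attErr, vee, hat, Matrix.trace, Matrix.mul_apply, dotProduct, Fin.sum_univ_three]
  ring

theorem hasDerivAt_Psi {R : ℝ → Matrix (Fin 3) (Fin 3) ℝ} {w : Fin 3 → ℝ} {t : ℝ}
    (hR : HasDerivAt R (R t * hat w) t) :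
    HasDerivAt (fun s => Psi (R s)) (attErr (R t) ⬝ᵥ w) t := by
  have h : HasDerivAt (fun s => (R s).trace) (R t * hat w).trace t :=
    (LinearMap.toContinuousLinearMap
      (Matrix.traceLinearMap (Fin 3) ℝ ℝ)).hasFDerivAt.comp_hasDerivAt t hR
  refine (((h.const_sub (3 : ℝ)).const_mul (1 / 2 : ℝ)).congr_deriv ?_).congr_of_eventuallyEq
    (Filter.Eventually.of_forall fun s => ?_)
  · rw [attErr_dotProduct]
    simp
  · simp [Psi, Matrix.trace_sub]

theorem hasDerivAt_quadraticForm {n : ℕ} {P : Matrix (Fin n) (Fin n) ℝ} (hP : Pᵀ = P)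
    {x : ℝ → Fin n → ℝ} {v : Fin n → ℝ} {t : ℝ} (hx : HasDerivAt x v t) :
    HasDerivAt (fun s => x s ⬝ᵥ (P *ᵥ x s)) (2 * (x t ⬝ᵥ (P *ᵥ v))) t := by
  have hPx : HasDerivAt (fun s => P *ᵥ x s) (P *ᵥ v) t :=
    (LinearMap.toContinuousLinearMap P.mulVecLin).hasFDerivAt.comp_hasDerivAt t hx
  have h : HasDerivAt (fun s => x s ⬝ᵥ (P *ᵥ x s))
      (∑ i, (v i * (P *ᵥ x t) i + x t i * (P *ᵥ v) i)) t :=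
    HasDerivAt.fun_sum fun i _ => (hasDerivAt_pi.1 hx i).mul (hasDerivAt_pi.1 hPx i)
  convert h using 1
  have hsymm : v ⬝ᵥ (P *ᵥ x t) = x t ⬝ᵥ (P *ᵥ v) := by
    rw [dotProduct_mulVec, ← mulVec_transpose, hP, dotProduct_comm]
  rw [Finset.sum_add_distrib]
  change _ = v ⬝ᵥ (P *ᵥ x t) + x t ⬝ᵥ (P *ᵥ v)
  rw [hsymm, two_mul]

theorem Qmat_quadraticForm {n : ℕ} (A_R : Matrix (Fin n) (Fin n) ℝ)
    (B_R : Matrix (Fin n) (Fin 3) ℝ) (C_R : Matrix (Fin 3) (Fin n) ℝ)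
    (D_R : Matrix (Fin 3) (Fin 3) ℝ) {P : Matrix (Fin n) (Fin n) ℝ} (hP : Pᵀ = P)
    (e : Fin 3 → ℝ) (x : Fin n → ℝ) :
    Sum.elim e x ⬝ᵥ (Qmat A_R B_R C_R D_R P *ᵥ Sum.elim e x) =
      e ⬝ᵥ (C_R *ᵥ x + D_R *ᵥ e) + 2 * (x ⬝ᵥ (P *ᵥ (A_R *ᵥ x + B_R *ᵥ e))) := by
  have hswap : e ⬝ᵥ ((P * B_R + (1 / 2 : ℝ) • C_Rᵀ)ᵀ *ᵥ x) =
      x ⬝ᵥ ((P * B_R + (1 / 2 : ℝ) • C_Rᵀ) *ᵥ e) := by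
    rw [mulVec_transpose, dotProduct_comm, dotProduct_mulVec]
  have hC : x ⬝ᵥ (C_Rᵀ *ᵥ e) = e ⬝ᵥ (C_R *ᵥ x) := by
    rw [mulVec_transpose, dotProduct_comm, dotProduct_mulVec]
  have hA : x ⬝ᵥ ((A_Rᵀ * P) *ᵥ x) = x ⬝ᵥ ((P * A_R) *ᵥ x) := by
    rw [← hP, ← transpose_mul, hP, mulVec_transpose, dotProduct_comm, dotProduct_mulVec]
  rw [Qmat, fromBlocks_mulVec, sumElim_dotProduct_sumElim]
  simp only [Sum.elim_comp_inl, Sum.elim_comp_inr, dotProduct_add, hswap]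
  simp only [add_mulVec, smul_mulVec, dotProduct_add, dotProduct_smul, hC, hA, mulVec_add,
    mulVec_mulVec, smul_eq_mul]
  ring

/-- Lyapunov decrease for the geometric NDI attitude loop with linear dynamic
compensator `(A_R, B_R, C_R, D_R)`:  if `P = Pᵀ ≻ 0` and `𝒬 ≺ 0`, then along the
closed-loop dynamics `ẋ = A_R x + B_R e_R`, `Ṙ = R (C_R x + D_R e_R)^×`, the
Lyapunov function `V = Ψ(R) + xᵀ P x` satisfies `V̇ = zᵀ 𝒬 z < 0` for `z = (e_R, x) ≠ 0`. -/
theorem attitude_loop_lyapunov_decrease {n : ℕ}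
    (A_R : Matrix (Fin n) (Fin n) ℝ) (B_R : Matrix (Fin n) (Fin 3) ℝ)
    (C_R : Matrix (Fin 3) (Fin n) ℝ) (D_R : Matrix (Fin 3) (Fin 3) ℝ)
    (P : Matrix (Fin n) (Fin n) ℝ) (hPsymm : Pᵀ = P) (hPpos : P.PosDef)
    (hQ : ∀ z : Fin 3 ⊕ Fin n → ℝ, z ≠ 0 → z ⬝ᵥ (Qmat A_R B_R C_R D_R P *ᵥ z) < 0)
    (R : ℝ → Matrix (Fin 3) (Fin 3) ℝ) (x : ℝ → Fin n → ℝ)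
    (hSO3 : ∀ t, SO3 (R t))
    (hx : ∀ t, HasDerivAt x (A_R *ᵥ x t + B_R *ᵥ attErr (R t)) t)
    (hR : ∀ t, HasDerivAt R (R t * hat (C_R *ᵥ x t + D_R *ᵥ attErr (R t))) t)
    (t : ℝ) :
    HasDerivAt (fun s => Psi (R s) + x s ⬝ᵥ (P *ᵥ x s))
      (Sum.elim (attErr (R t)) (x t) ⬝ᵥ
        (Qmat A_R B_R C_R D_R P *ᵥ Sum.elim (attErr (R t)) (x t))) t ∧
    (Sum.elim (attErr (R t)) (x t) ≠ 0 →
      Sum.elim (attErr (R t)) (x t) ⬝ᵥ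
        (Qmat A_R B_R C_R D_R P *ᵥ Sum.elim (attErr (R t)) (x t)) < 0) := by
  refine ⟨?_, hQ _⟩
  rw [Qmat_quadraticForm A_R B_R C_R D_R hPsymm]
  exact (hasDerivAt_Psi (hR t)).add (hasDerivAt_quadraticForm hPsymm (hx t))
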